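/- c(2,5) = 7 and c(2,4) = 8; in particular c(2,5) < c(2,4), so c(n,k) is not monotonically nondecreasing in k. -/

import Mathlib

open Pointwise

noncomputable section

/-- The set of lattice (integer) points in `ℝ^n`. -/
def lat (n : ℕ) : Set (Fin n → ℝ) := {x | ∀ j, ∃ z : ℤ, x j = (z : ℝ)}

/-- The polyhedron determined by the subsystem of `A x ≤ b` indexed by `I`. -/
def polyI {n m : ℕ} (A : Fin m → Fin n → ℝ) (b : Fin m → ℝ) (I : Set (Fin m)) :
    Set (Fin n → ℝ) := {x | ∀ i ∈ I, ∑ j, A i j * x j ≤ b i}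

/-- The integer points of a set `S ⊆ ℝ^n`. -/
def intPts {n : ℕ} (S : Set (Fin n → ℝ)) : Set (Fin n → ℝ) := S ∩ lat n

/-- `c` is a valid Helly-type bound for dimension `n` and `k` integer points:
any polyhedron with exactly `k` integer points has a subsystem of at most `c`
inequalities with exactly the same integer points. -/
def HellyBound (n k c : ℕ) : Prop :=
  ∀ (m : ℕ) (A : Fin m → Fin n → ℝ) (b : Fin m → ℝ),
    (intPts (polyI A b Set.univ)).Finite →
    (intPts (polyI A b Set.univ)).ncard = k →
    ∃ I : Finset (Fin m), I.card ≤ c ∧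
      intPts (polyI A b (↑I : Set (Fin m))) = intPts (polyI A b Set.univ)

/-- The quantity `c(n,k)`: the least valid Helly-type bound. -/
def cnk (n k : ℕ) : ℕ := sInf {c | HellyBound n k c}

/-- A set of points is in convex position if no point of it lies in the convex
hull of the others. -/
def ConvexPos {n : ℕ} (V : Set (Fin n → ℝ)) : Prop :=
  ∀ v ∈ V, v ∉ convexHull ℝ (V \ {v})

/-- `iconv V = conv(V) ∩ ℤ^n`. -/
def iconv {n : ℕ} (V : Set (Fin n → ℝ)) : Set (Fin n → ℝ) :=
  convexHull ℝ V ∩ lat n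

/-- `ℓ(n,k)`: the smallest integer `s` such that every set `V ⊆ ℤ^n` in convex
position with `|V| = s` satisfies `|iconv(V) \ V| ≥ k`. -/
def ellnk (n k : ℕ) : ℕ :=
  sInf {s | ∀ V : Set (Fin n → ℝ), V ⊆ lat n → ConvexPos V → V.Finite →
    V.ncard = s → k ≤ (iconv V \ V).ncard}

/-- The set of midpoints of `V` that are not in `V`. -/
def midpts {n : ℕ} (V : Set (Fin n → ℝ)) : Set (Fin n → ℝ) :=
  {p | ∃ x ∈ V, ∃ y ∈ V, p = (1/2 : ℝ) • (x + y)} \ V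

/-- `μ_c(n,s)`: the minimum number of midpoints `|M(V)|` over all sets
`V ⊆ ℝ^n` in convex position with `|V| = s`. -/
def muc (n s : ℕ) : ℕ :=
  sInf {m | ∃ V : Set (Fin n → ℝ), ConvexPos V ∧ V.Finite ∧ V.ncard = s ∧
    (midpts V).ncard = m}

/-- `α(n,k)`: the maximum cardinality of a set `V ⊆ ℤ^n` in convex position
with `|iconv(V) \ V| = k`. -/
def alphank (n k : ℕ) : ℕ :=
  sSup {m | ∃ V : Set (Fin n → ℝ), V ⊆ lat n ∧ ConvexPos V ∧ V.Finite ∧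
    V.ncard = m ∧ (iconv V \ V).ncard = k}

/-- A system `A x ≤ b` is non-redundant if removing any single inequality
strictly increases the set of integer points. -/
def NonRedundant {n m : ℕ} (A : Fin m → Fin n → ℝ) (b : Fin m → ℝ) : Prop :=
  ∀ i : Fin m,
    intPts (polyI A b Set.univ) ⊂ intPts (polyI A b ({i}ᶜ : Set (Fin m)))

/-- The set of lattice (integer) points in Euclidean space `ℝ^n`. -/
def latE (n : ℕ) : Set (EuclideanSpace ℝ (Fin n)) := {x | ∀ j, ∃ z : ℤ, x j = (z : ℝ)}

set_option linter.unusedSimpArgs false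

abbrev Pt := ℤ × ℤ

def Cfg (K V : Finset Pt) : Prop :=
  Disjoint K V ∧ ∀ a b c w : Pt, a ∈ K ∪ V → b ∈ K ∪ V → c ∈ K ∪ V → ∀ α β γ : ℤ,
    0 ≤ α → 0 ≤ β → 0 ≤ γ → 0 < α + β + γ →
    (α + β + γ) * w.1 = α * a.1 + β * b.1 + γ * c.1 →
    (α + β + γ) * w.2 = α * a.2 + β * b.2 + γ * c.2 →
    w ∈ K ∨ w = a ∨ w = b ∨ w = c

/-- Signed area form of the edge `e` at `x`. -/
def edgeF (e : Pt × Pt) (x : Pt) : ℤ :=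
  (e.2.1 - e.1.1) * (x.2 - e.1.2) - (e.2.2 - e.1.2) * (x.1 - e.1.1)

/-- closedness of `K` -/
lemma Cfg.kclosed {K V : Finset Pt} (C : Cfg K V) {a b c : Pt} (w : Pt) (ha : a ∈ K) (hb : b ∈ K)
    (hc : c ∈ K) (α β γ : ℤ) (h1 : 0 ≤ α) (h2 : 0 ≤ β) (h3 : 0 ≤ γ) (h : 0 < α + β + γ)
    (e1 : (α + β + γ) * w.1 = α * a.1 + β * b.1 + γ * c.1)
    (e2 : (α + β + γ) * w.2 = α * a.2 + β * b.2 + γ * c.2) : w ∈ K := by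
  rcases C.2 a b c w (by simp [ha]) (by simp [hb]) (by simp [hc]) α β γ h1 h2 h3 h e1 e2 with
    h | h | h | h
  · exact h
  all_goals (subst h; assumption)

lemma ceil_ex (X D : ℤ) (hD : 0 < D) : ∃ t : ℤ, 0 ≤ D * t - X ∧ D * t - X ≤ D - 1 := by
  refine ⟨-((-X) / D), ?_, ?_⟩
  · have := Int.emod_add_mul_ediv (-X) D
    have := Int.emod_nonneg (-X) hD.ne'
    nlinarith
  · have := Int.emod_add_mul_ediv (-X) D
    have := Int.emod_lt_of_pos (-X) hD
    nlinarith

/-- lattice point at height one in a triangle -/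
lemma Cfg.height {K V : Finset Pt} (C : Cfg K V) {a b v : Pt} (ha : a ∈ K) (hb : b ∈ K)
    (hv : v ∈ K ∪ V) (hg : IsCoprime (b.1 - a.1) (b.2 - a.2)) (hD : 2 ≤ edgeF (a, b) v) :
    ∃ w ∈ K, edgeF (a, b) w = 1 := by
  obtain ⟨s, r, hsr⟩ := hg
  obtain ⟨t, ht0, ht1⟩ := ceil_ex ((v.1 - a.1) * s + (v.2 - a.2) * r) (edgeF (a, b) v) (by omega)
  set D := edgeF (a, b) v with hDdef
  set X := (v.1 - a.1) * s + (v.2 - a.2) * r with hX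
  simp only [edgeF] at hDdef
  have hw1 : edgeF (a, b) (a.1 + t * (b.1 - a.1) - r, a.2 + t * (b.2 - a.2) + s) = 1 := by
    simp only [edgeF]; linear_combination hsr
  refine ⟨_, ?_, hw1⟩
  have e1 : v.1 - a.1 = X * (b.1 - a.1) - D * r := by
    rw [hDdef, hX]; linear_combination (-(v.1 - a.1)) * hsr
  have e2 : v.2 - a.2 = X * (b.2 - a.2) + D * s := by
    rw [hDdef, hX]; linear_combination (-(v.2 - a.2)) * hsr
  rcases C.2 v a b (a.1 + t * (b.1 - a.1) - r, a.2 + t * (b.2 - a.2) + s) hv (by simp [ha])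
    (by simp [hb]) 1 (D - 1 - (D * t - X)) (D * t - X) (by omega) (by omega) ht0 (by omega)
    (by simp only; linear_combination (-1) * e1) (by simp only; linear_combination (-1) * e2) with
    h | h | h | h
  · exact h
  · rw [h] at hw1; simp only [edgeF] at hw1; omega
  · rw [h] at hw1; simp only [edgeF] at hw1; ring_nf at hw1; omega
  · rw [h] at hw1; simp only [edgeF] at hw1; ring_nf at hw1; omega

lemma Cfg.edge {K V : Finset Pt} (C : Cfg K V) {a b v : Pt} (ha : a ∈ K) (hb : b ∈ K)
    (hv : v ∈ V) (hg : IsCoprime (b.1 - a.1) (b.2 - a.2)) (hK : ∀ n ∈ K, edgeF (a, b) n ≤ 0) :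
    edgeF (a, b) v ≤ 1 := by
  by_contra h
  obtain ⟨w, hw, hw1⟩ := C.height ha hb (v := v) (by simp [hv]) hg (by omega)
  have := hK w hw
  omega

lemma Cfg.noMid {K V : Finset Pt} (C : Cfg K V) {p q s r c : ℤ} (h1 : p * s + q * r = 1)
    {x y z : Pt} (hx : x ∈ V) (hy : y ∈ V) (hz : z ∈ V)
    (ex : p * x.1 + q * x.2 = c) (ey : p * y.1 + q * y.2 = c) (ez : p * z.1 + q * z.2 = c)
    (hxy : -r * x.1 + s * x.2 < -r * y.1 + s * y.2)
    (hyz : -r * y.1 + s * y.2 < -r * z.1 + s * z.2) : False := by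
  have inv : ∀ x : Pt, x.1 = s * (p * x.1 + q * x.2) - q * (-r * x.1 + s * x.2) ∧
      x.2 = r * (p * x.1 + q * x.2) + p * (-r * x.1 + s * x.2) := fun x =>
    ⟨by linear_combination (-x.1) * h1, by linear_combination (-x.2) * h1⟩
  obtain ⟨x1, x2⟩ := inv x
  obtain ⟨y1, y2⟩ := inv y
  obtain ⟨z1, z2⟩ := inv z
  rw [ex] at x1 x2
  rw [ey] at y1 y2
  rw [ez] at z1 z2
  set X := -r * x.1 + s * x.2
  set Y := -r * y.1 + s * y.2
  set Z := -r * z.1 + s * z.2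
  rcases C.2 x z z y (by simp [hx]) (by simp [hz]) (by simp [hz]) (Z - Y) (Y - X) 0
    (by omega) (by omega) (by omega) (by omega)
    (by rw [x1, y1, z1]; ring) (by rw [x2, y2, z2]; ring) with h | h | h | h
  · exact Finset.disjoint_left.1 C.1 h hy
  · have : Y = X := by simp only [X, Y, h]
    omega
  all_goals
    have : Y = Z := by simp only [Z, Y, h]
    omega

lemma Cfg.line {K V : Finset Pt} (C : Cfg K V) {p q c : ℤ} (hg : IsCoprime p q) :
    (V.filter (fun x => p * x.1 + q * x.2 = c)).card ≤ 2 := by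
  obtain ⟨s, r, h1⟩ := hg
  have h1 : p * s + q * r = 1 := by linarith
  by_contra h
  push Not at h
  obtain ⟨x, hx, y, hy, z, hz, hxy, hxz, hyz⟩ := Finset.two_lt_card.1 h
  simp only [Finset.mem_filter] at hx hy hz
  have inj : ∀ x y : Pt, p * x.1 + q * x.2 = c → p * y.1 + q * y.2 = c → x ≠ y →
      -r * x.1 + s * x.2 ≠ -r * y.1 + s * y.2 := by
    intro x y hx hy hne he
    apply hne
    ext
    · linear_combination (-(x.1 - y.1)) * h1 + s * (hx - hy) - q * he
    · linear_combination (-(x.2 - y.2)) * h1 + r * (hx - hy) + p * he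
  have a1 := inj x y hx.2 hy.2 hxy
  have a2 := inj x z hx.2 hz.2 hxz
  have a3 := inj y z hy.2 hz.2 hyz
  rcases lt_or_gt_of_ne a1 with a1 | a1 <;> rcases lt_or_gt_of_ne a2 with a2 | a2 <;>
    rcases lt_or_gt_of_ne a3 with a3 | a3
  · exact C.noMid h1 hx.1 hy.1 hz.1 hx.2 hy.2 hz.2 a1 a3
  · exact C.noMid h1 hx.1 hz.1 hy.1 hx.2 hz.2 hy.2 a2 a3
  · omega
  · exact C.noMid h1 hz.1 hx.1 hy.1 hz.2 hx.2 hy.2 a2 a1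
  · exact C.noMid h1 hy.1 hx.1 hz.1 hy.2 hx.2 hz.2 a1 a2
  · omega
  · exact C.noMid h1 hy.1 hz.1 hx.1 hy.2 hz.2 hx.2 a3 a2
  · exact C.noMid h1 hz.1 hy.1 hx.1 hz.2 hy.2 hx.2 a3 a1

lemma Cfg.edgeCard {K V : Finset Pt} (C : Cfg K V) (e : Pt × Pt)
    (hg : IsCoprime (e.2.1 - e.1.1) (e.2.2 - e.1.2)) :
    (V.filter (fun x => edgeF e x = 1)).card ≤ 2 := by
  have := C.line (p := -(e.2.2 - e.1.2)) (q := e.2.1 - e.1.1)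
    (c := 1 + (e.2.1 - e.1.1) * e.1.2 - (e.2.2 - e.1.2) * e.1.1) hg.symm.neg_left
  refine le_trans (Finset.card_le_card ?_) this
  intro x hx
  rw [Finset.mem_filter] at hx ⊢
  obtain ⟨hx, hx2⟩ := hx
  simp only [edgeF] at hx2
  exact ⟨hx, by linarith⟩

/-- main counting lemma -/
lemma Cfg.count {K V : Finset Pt} (C : Cfg K V) (E E' : Finset (Pt × Pt)) (R : Finset Pt)
    (hE : ∀ e ∈ E ∪ E', e.1 ∈ K ∧ e.2 ∈ K ∧ Int.gcd (e.2.1 - e.1.1) (e.2.2 - e.1.2) = 1 ∧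
      ∀ n ∈ K, edgeF e n ≤ 0)
    (hcov : ∀ x, x ∉ K → (∀ e ∈ E, edgeF e x ≤ 0) → (∀ e ∈ E', edgeF e x ≤ 1) → x ∈ R) :
    V.card ≤ E.card * 2 + R.card := by
  have key : V ⊆ E.biUnion (fun e => V.filter (fun x => edgeF e x = 1)) ∪ R := by
    intro x hx
    rw [Finset.mem_union]
    by_cases h : ∀ e ∈ E, edgeF e x ≤ 0
    · right
      refine hcov x (fun hk => Finset.disjoint_left.1 C.1 hk hx) h fun e he => ?_
      obtain ⟨h1, h2, h3, h4⟩ := hE e (by simp [he])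
      exact C.edge h1 h2 hx (Int.isCoprime_iff_gcd_eq_one.2 h3) h4
    · left
      push Not at h
      obtain ⟨e, he, hp⟩ := h
      obtain ⟨h1, h2, h3, h4⟩ := hE e (by simp [he])
      have := C.edge h1 h2 hx (Int.isCoprime_iff_gcd_eq_one.2 h3) h4
      simp only [Finset.mem_biUnion, Finset.mem_filter]
      have h5 : edgeF e x ≤ 1 := this
      exact ⟨e, he, hx, by omega⟩
  refine (Finset.card_le_card key).trans ((Finset.card_union_le _ _).trans ?_)
  gcongr
  apply Finset.card_biUnion_le_card_mul
  intro e he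
  obtain ⟨h1, h2, h3, h4⟩ := hE e (by simp [he])
  exact C.edgeCard e (Int.isCoprime_iff_gcd_eq_one.2 h3)

/-- collinear case -/
lemma Cfg.collinear {K V : Finset Pt} (C : Cfg K V) (h0 : ((0, 0) : Pt) ∈ K)
    (h1 : ((1, 0) : Pt) ∈ K) (hK : ∀ n ∈ K, n.2 = 0) : V.card ≤ 6 := by
  have a1 := C.edgeCard ((0, 0), (1, 0)) (Int.isCoprime_iff_gcd_eq_one.2 (by decide))
  have a2 := C.edgeCard ((1, 0), (0, 0)) (Int.isCoprime_iff_gcd_eq_one.2 (by decide))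
  have a3 := C.line (p := 0) (q := 1) (c := 0) (Int.isCoprime_iff_gcd_eq_one.2 (by decide))
  have key : V ⊆ (V.filter (fun x => edgeF ((0, 0), (1, 0)) x = 1) ∪
      V.filter (fun x => edgeF ((1, 0), (0, 0)) x = 1)) ∪
      V.filter (fun x => 0 * x.1 + 1 * x.2 = 0) := by
    intro x hx
    have b1 := C.edge h0 h1 hx (Int.isCoprime_iff_gcd_eq_one.2 (by decide)) (fun n hn => by simp [edgeF, hK n hn])
    have b2 := C.edge h1 h0 hx (Int.isCoprime_iff_gcd_eq_one.2 (by decide)) (fun n hn => by simp [edgeF, hK n hn])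
    clear a1 a2 a3
    simp only [Finset.mem_union, Finset.mem_filter, hx, true_and]
    simp only [edgeF] at *
    omega
  have := Finset.card_le_card key
  have := Finset.card_union_le (V.filter (fun x => edgeF ((0, 0), (1, 0)) x = 1) ∪
      V.filter (fun x => edgeF ((1, 0), (0, 0)) x = 1)) (V.filter (fun x => 0 * x.1 + 1 * x.2 = 0))
  have := Finset.card_union_le (V.filter (fun x => edgeF ((0, 0), (1, 0)) x = 1))
      (V.filter (fun x => edgeF ((1, 0), (0, 0)) x = 1))
  omega
lemma Cfg.cases_four {V : Finset Pt} (s : Pt) (C : Cfg {(0, 0), (1, 0), (0, 1), s} V)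
    (hs : s = (-1, -1) ∨ s = (0, -1) ∨ s = (1, -1) ∨ s = (2, -1) ∨ s = (3, -1) ∨ s = (-1, 0) ∨ s = (-1, 1) ∨ s = (-1, 2) ∨ s = (-1, 3) ∨ s = (2, 0) ∨ s = (1, 1) ∨ s = (0, 2)) :
    V.card ≤ 8 := by
  rcases hs with rfl | rfl | rfl | rfl | rfl | rfl | rfl | rfl | rfl | rfl | rfl | rfl
  · refine (C.count {((0, 1), (1, 0)), ((1, 0), (-1, -1)), ((-1, -1), (0, 1))} ∅ ∅ (by decide) ?_).trans (by decide)
    rintro ⟨x, y⟩ hx h h'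
    simp only [Finset.mem_insert, Finset.mem_singleton, Prod.mk.injEq, forall_eq_or_imp, forall_eq,
      edgeF, Finset.notMem_empty, false_imp_iff, implies_true] at *
    omega
  · refine (C.count {((0, 1), (1, 0)), ((1, 0), (0, -1)), ((0, -1), (0, 0))} ∅ ∅ (by decide) ?_).trans (by decide)
    rintro ⟨x, y⟩ hx h h'
    simp only [Finset.mem_insert, Finset.mem_singleton, Prod.mk.injEq, forall_eq_or_imp, forall_eq,
      edgeF, Finset.notMem_empty, false_imp_iff, implies_true] at *
    omega
  · refine (C.count {((0, 1), (1, 0)), ((1, 0), (1, -1)), ((1, -1), (0, 0)), ((0, 0), (0, 1))} ∅ ∅ (by decide) ?_).trans (by decide)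
    rintro ⟨x, y⟩ hx h h'
    simp only [Finset.mem_insert, Finset.mem_singleton, Prod.mk.injEq, forall_eq_or_imp, forall_eq,
      edgeF, Finset.notMem_empty, false_imp_iff, implies_true] at *
    omega
  · refine (C.count {((0, 1), (1, 0)), ((2, -1), (0, 0)), ((0, 0), (0, 1))} ∅ ∅ (by decide) ?_).trans (by decide)
    rintro ⟨x, y⟩ hx h h'
    simp only [Finset.mem_insert, Finset.mem_singleton, Prod.mk.injEq, forall_eq_or_imp, forall_eq,
      edgeF, Finset.notMem_empty, false_imp_iff, implies_true] at *
    omega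
  · refine (C.count {((0, 1), (3, -1)), ((3, -1), (0, 0)), ((0, 0), (0, 1))} ∅ ∅ (by decide) ?_).trans (by decide)
    rintro ⟨x, y⟩ hx h h'
    simp only [Finset.mem_insert, Finset.mem_singleton, Prod.mk.injEq, forall_eq_or_imp, forall_eq,
      edgeF, Finset.notMem_empty, false_imp_iff, implies_true] at *
    omega
  · refine (C.count {((0, 1), (1, 0)), ((1, 0), (0, 0)), ((-1, 0), (0, 1))} ∅ ∅ (by decide) ?_).trans (by decide)
    rintro ⟨x, y⟩ hx h h'
    simp only [Finset.mem_insert, Finset.mem_singleton, Prod.mk.injEq, forall_eq_or_imp, forall_eq,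
      edgeF, Finset.notMem_empty, false_imp_iff, implies_true] at *
    omega
  · refine (C.count {((0, 1), (1, 0)), ((1, 0), (0, 0)), ((0, 0), (-1, 1)), ((-1, 1), (0, 1))} ∅ ∅ (by decide) ?_).trans (by decide)
    rintro ⟨x, y⟩ hx h h'
    simp only [Finset.mem_insert, Finset.mem_singleton, Prod.mk.injEq, forall_eq_or_imp, forall_eq,
      edgeF, Finset.notMem_empty, false_imp_iff, implies_true] at *
    omega
  · refine (C.count {((1, 0), (0, 0)), ((0, 0), (-1, 2)), ((-1, 2), (0, 1))} ∅ ∅ (by decide) ?_).trans (by decide)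
    rintro ⟨x, y⟩ hx h h'
    simp only [Finset.mem_insert, Finset.mem_singleton, Prod.mk.injEq, forall_eq_or_imp, forall_eq,
      edgeF, Finset.notMem_empty, false_imp_iff, implies_true] at *
    omega
  · refine (C.count {((1, 0), (0, 0)), ((0, 0), (-1, 3)), ((-1, 3), (1, 0))} ∅ ∅ (by decide) ?_).trans (by decide)
    rintro ⟨x, y⟩ hx h h'
    simp only [Finset.mem_insert, Finset.mem_singleton, Prod.mk.injEq, forall_eq_or_imp, forall_eq,
      edgeF, Finset.notMem_empty, false_imp_iff, implies_true] at *
    omega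
  · refine (C.count {((0, 1), (2, 0)), ((2, 0), (1, 0)), ((0, 0), (0, 1))} ∅ ∅ (by decide) ?_).trans (by decide)
    rintro ⟨x, y⟩ hx h h'
    simp only [Finset.mem_insert, Finset.mem_singleton, Prod.mk.injEq, forall_eq_or_imp, forall_eq,
      edgeF, Finset.notMem_empty, false_imp_iff, implies_true] at *
    omega
  · refine (C.count {((0, 1), (1, 1)), ((1, 1), (1, 0)), ((1, 0), (0, 0)), ((0, 0), (0, 1))} ∅ ∅ (by decide) ?_).trans (by decide)
    rintro ⟨x, y⟩ hx h h'
    simp only [Finset.mem_insert, Finset.mem_singleton, Prod.mk.injEq, forall_eq_or_imp, forall_eq,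
      edgeF, Finset.notMem_empty, false_imp_iff, implies_true] at *
    omega
  · refine (C.count {((0, 2), (1, 0)), ((1, 0), (0, 0)), ((0, 0), (0, 1))} ∅ ∅ (by decide) ?_).trans (by decide)
    rintro ⟨x, y⟩ hx h h'
    simp only [Finset.mem_insert, Finset.mem_singleton, Prod.mk.injEq, forall_eq_or_imp, forall_eq,
      edgeF, Finset.notMem_empty, false_imp_iff, implies_true] at *
    omega

lemma Cfg.cases_five {V : Finset Pt} (s : Pt) (C : Cfg {(-1, 0), (0, 0), (1, 0), (0, 1), s} V)
    (hs : s = (-2, 0) ∨ s = (2, 0) ∨ s = (1, 1) ∨ s = (-1, 1) ∨ s = (0, 2) ∨ s = (-3, -1) ∨ s = (-2, -1) ∨ s = (-1, -1) ∨ s = (0, -1) ∨ s = (1, -1) ∨ s = (2, -1) ∨ s = (3, -1)) :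
    V.card ≤ 7 := by
  rcases hs with rfl | rfl | rfl | rfl | rfl | rfl | rfl | rfl | rfl | rfl | rfl | rfl
  · refine (C.count {((0, 1), (1, 0)), ((1, 0), (0, 0)), ((-2, 0), (0, 1))} ∅ ∅ (by decide) ?_).trans (by decide)
    rintro ⟨x, y⟩ hx h h'
    simp only [Finset.mem_insert, Finset.mem_singleton, Prod.mk.injEq, forall_eq_or_imp, forall_eq,
      edgeF, Finset.notMem_empty, false_imp_iff, implies_true] at *
    omega
  · refine (C.count {((0, 1), (2, 0)), ((2, 0), (1, 0)), ((-1, 0), (0, 1))} ∅ ∅ (by decide) ?_).trans (by decide)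
    rintro ⟨x, y⟩ hx h h'
    simp only [Finset.mem_insert, Finset.mem_singleton, Prod.mk.injEq, forall_eq_or_imp, forall_eq,
      edgeF, Finset.notMem_empty, false_imp_iff, implies_true] at *
    omega
  · refine (C.count {((1, 1), (1, 0)), ((1, 0), (0, 0)), ((-1, 0), (0, 1))} {((0, 1), (1, 1))} {(1, 2)} (by decide) ?_).trans (by decide)
    rintro ⟨x, y⟩ hx h h'
    simp only [Finset.mem_insert, Finset.mem_singleton, Prod.mk.injEq, forall_eq_or_imp, forall_eq,
      edgeF, Finset.notMem_empty, false_imp_iff, implies_true] at *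
    omega
  · refine (C.count {((0, 1), (1, 0)), ((1, 0), (0, 0)), ((-1, 0), (-1, 1))} {((-1, 1), (0, 1))} {(-1, 2)} (by decide) ?_).trans (by decide)
    rintro ⟨x, y⟩ hx h h'
    simp only [Finset.mem_insert, Finset.mem_singleton, Prod.mk.injEq, forall_eq_or_imp, forall_eq,
      edgeF, Finset.notMem_empty, false_imp_iff, implies_true] at *
    omega
  · refine (C.count {((0, 2), (1, 0)), ((1, 0), (0, 0)), ((-1, 0), (0, 2))} ∅ ∅ (by decide) ?_).trans (by decide)
    rintro ⟨x, y⟩ hx h h'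
    simp only [Finset.mem_insert, Finset.mem_singleton, Prod.mk.injEq, forall_eq_or_imp, forall_eq,
      edgeF, Finset.notMem_empty, false_imp_iff, implies_true] at *
    omega
  · refine (C.count {((0, 1), (1, 0)), ((1, 0), (-3, -1)), ((-3, -1), (0, 1))} ∅ ∅ (by decide) ?_).trans (by decide)
    rintro ⟨x, y⟩ hx h h'
    simp only [Finset.mem_insert, Finset.mem_singleton, Prod.mk.injEq, forall_eq_or_imp, forall_eq,
      edgeF, Finset.notMem_empty, false_imp_iff, implies_true] at *
    omega
  · refine (C.count {((0, 1), (1, 0)), ((1, 0), (-2, -1)), ((-2, -1), (-1, 0))} ∅ ∅ (by decide) ?_).trans (by decide)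
    rintro ⟨x, y⟩ hx h h'
    simp only [Finset.mem_insert, Finset.mem_singleton, Prod.mk.injEq, forall_eq_or_imp, forall_eq,
      edgeF, Finset.notMem_empty, false_imp_iff, implies_true] at *
    omega
  · refine (C.count {((0, 1), (1, 0)), ((1, 0), (-1, -1)), ((-1, -1), (-1, 0))} {((-1, 0), (0, 1))} {(-1, 1)} (by decide) ?_).trans (by decide)
    rintro ⟨x, y⟩ hx h h'
    simp only [Finset.mem_insert, Finset.mem_singleton, Prod.mk.injEq, forall_eq_or_imp, forall_eq,
      edgeF, Finset.notMem_empty, false_imp_iff, implies_true] at *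
    omega
  · refine (C.count {((1, 0), (0, -1)), ((0, -1), (-1, 0)), ((-1, 0), (0, 1))} {((0, 1), (1, 0))} {(1, 1)} (by decide) ?_).trans (by decide)
    rintro ⟨x, y⟩ hx h h'
    simp only [Finset.mem_insert, Finset.mem_singleton, Prod.mk.injEq, forall_eq_or_imp, forall_eq,
      edgeF, Finset.notMem_empty, false_imp_iff, implies_true] at *
    omega
  · refine (C.count {((1, 0), (1, -1)), ((1, -1), (-1, 0)), ((-1, 0), (0, 1))} {((0, 1), (1, 0))} {(1, 1)} (by decide) ?_).trans (by decide)
    rintro ⟨x, y⟩ hx h h'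
    simp only [Finset.mem_insert, Finset.mem_singleton, Prod.mk.injEq, forall_eq_or_imp, forall_eq,
      edgeF, Finset.notMem_empty, false_imp_iff, implies_true] at *
    omega
  · refine (C.count {((0, 1), (1, 0)), ((2, -1), (-1, 0)), ((-1, 0), (0, 1))} ∅ ∅ (by decide) ?_).trans (by decide)
    rintro ⟨x, y⟩ hx h h'
    simp only [Finset.mem_insert, Finset.mem_singleton, Prod.mk.injEq, forall_eq_or_imp, forall_eq,
      edgeF, Finset.notMem_empty, false_imp_iff, implies_true] at *
    omega
  · refine (C.count {((0, 1), (3, -1)), ((3, -1), (-1, 0)), ((-1, 0), (0, 1))} ∅ ∅ (by decide) ?_).trans (by decide)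
    rintro ⟨x, y⟩ hx h h'
    simp only [Finset.mem_insert, Finset.mem_singleton, Prod.mk.injEq, forall_eq_or_imp, forall_eq,
      edgeF, Finset.notMem_empty, false_imp_iff, implies_true] at *
    omega

/-- affine unimodular coordinates -/
def affE (o u w : Pt) (δ : ℤ) (h : u.1 * w.2 - u.2 * w.1 = δ) (hδ : δ * δ = 1) : Pt ≃ Pt where
  toFun x := (o.1 + x.1 * u.1 + x.2 * w.1, o.2 + x.1 * u.2 + x.2 * w.2)
  invFun n := (δ * ((n.1 - o.1) * w.2 - (n.2 - o.2) * w.1),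
    δ * (u.1 * (n.2 - o.2) - u.2 * (n.1 - o.1)))
  left_inv x := by
    ext
    · simp only; linear_combination x.1 * δ * h + x.1 * hδ
    · simp only; linear_combination x.2 * δ * h + x.2 * hδ
  right_inv n := by
    ext
    · simp only; linear_combination (n.1 - o.1) * δ * h + (n.1 - o.1) * hδ
    · simp only; linear_combination (n.2 - o.2) * δ * h + (n.2 - o.2) * hδ

lemma Cfg.trans {K V : Finset Pt} (C : Cfg K V) (o u w : Pt) (δ : ℤ)
    (h : u.1 * w.2 - u.2 * w.1 = δ) (hδ : δ * δ = 1) :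
    ∃ K' V' : Finset Pt, Cfg K' V' ∧ K'.card = K.card ∧ V'.card = V.card ∧
      ∀ x : Pt, x ∈ K' ↔ (o.1 + x.1 * u.1 + x.2 * w.1, o.2 + x.1 * u.2 + x.2 * w.2) ∈ K := by
  set e := affE o u w δ h hδ with he
  have hm : ∀ (S : Finset Pt) (x : Pt), x ∈ S.map e.symm.toEmbedding ↔ e x ∈ S := by
    intro S x; rw [Finset.mem_map_equiv]; rfl
  have ex : ∀ x, e x = (o.1 + x.1 * u.1 + x.2 * w.1, o.2 + x.1 * u.2 + x.2 * w.2) := fun x => rfl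
  refine ⟨K.map e.symm.toEmbedding, V.map e.symm.toEmbedding, ⟨?_, ?_⟩, by simp, by simp,
    fun x => hm K x⟩
  · rw [Finset.disjoint_left]
    intro x hx hy
    rw [hm] at hx hy
    exact Finset.disjoint_left.1 C.1 hx hy
  · intro a b c z ha hb hc α β γ h1 h2 h3 h4 e1 e2
    rw [Finset.mem_union, hm, hm, ← Finset.mem_union] at ha hb hc
    rw [hm]
    have := C.2 (e a) (e b) (e c) (e z) ha hb hc α β γ h1 h2 h3 h4
      (by simp only [ex]; linear_combination u.1 * e1 + w.1 * e2)
      (by simp only [ex]; linear_combination u.2 * e1 + w.2 * e2)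
    simpa only [e.injective.eq_iff] using this

lemma Cfg.prim {K V : Finset Pt} (C : Cfg K V) {a b : Pt} (ha : a ∈ K) (hb : b ∈ K) (hab : a ≠ b) :
    ∃ (u : Pt) (g : ℤ), 0 < g ∧ IsCoprime u.1 u.2 ∧ b = (a.1 + g * u.1, a.2 + g * u.2) ∧
      ∀ i : ℤ, 0 ≤ i → i ≤ g → (a.1 + i * u.1, a.2 + i * u.2) ∈ K := by
  have hg : 0 < Int.gcd (b.1 - a.1) (b.2 - a.2) := by
    rw [Int.gcd_pos_iff]
    by_contra h
    push Not at h
    apply hab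
    ext <;> omega
  obtain ⟨x, y, hxy, h1, h2⟩ := Int.exists_gcd_one hg
  refine ⟨(x, y), Int.gcd (b.1 - a.1) (b.2 - a.2), by exact_mod_cast hg,
    Int.isCoprime_iff_gcd_eq_one.2 hxy, ?_, ?_⟩
  · ext
    · simp only; linarith
    · simp only; linarith
  · intro i hi hig
    set g : ℤ := (Int.gcd (b.1 - a.1) (b.2 - a.2) : ℤ)
    have hg' : 0 < g := Int.natCast_pos.2 hg
    refine C.kclosed (a := a) (b := b) (c := b) _ ha hb hb (g - i) i 0 (by omega) hi le_rfl
      (by omega) ?_ ?_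
    · simp only; linear_combination (-i) * h1
    · simp only; linear_combination (-i) * h2

/-- normalise so that the standard triangle lies in `K` -/
lemma Cfg.tri {K V : Finset Pt} (C : Cfg K V) (h0 : ((0, 0) : Pt) ∈ K)
    (h1 : ((1, 0) : Pt) ∈ K) (hK : ¬ ∀ n ∈ K, n.2 = 0) :
    ∃ K' V' : Finset Pt, Cfg K' V' ∧ K'.card = K.card ∧ V'.card = V.card ∧
      ((0, 0) : Pt) ∈ K' ∧ ((1, 0) : Pt) ∈ K' ∧ ((0, 1) : Pt) ∈ K' ∧
      (((-1, 0) : Pt) ∈ K → ((-1, 0) : Pt) ∈ K') := by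
  have : ∃ w ∈ K, w.2 * w.2 = 1 := by
    push Not at hK
    obtain ⟨n, hn, hn0⟩ := hK
    rcases lt_or_gt_of_ne hn0 with h | h
    · by_cases h2 : n.2 = -1
      · exact ⟨n, hn, by rw [h2]; rfl⟩
      · obtain ⟨w, hw, hw1⟩ := C.height h1 h0 (v := n) (by simp [hn])
          (Int.isCoprime_iff_gcd_eq_one.2 (by decide)) (by simp only [edgeF]; omega)
        refine ⟨w, hw, ?_⟩
        have : w.2 = -1 := by simp only [edgeF] at hw1; omega
        rw [this]; rfl
    · by_cases h2 : n.2 = 1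
      · exact ⟨n, hn, by rw [h2]; rfl⟩
      · obtain ⟨w, hw, hw1⟩ := C.height h0 h1 (v := n) (by simp [hn])
          (Int.isCoprime_iff_gcd_eq_one.2 (by decide)) (by simp only [edgeF]; omega)
        refine ⟨w, hw, ?_⟩
        have : w.2 = 1 := by simp only [edgeF] at hw1; omega
        rw [this]; rfl
  obtain ⟨w, hw, hw1⟩ := this
  obtain ⟨K', V', C', hk, hv, hm⟩ := C.trans (0, 0) (1, 0) w w.2 (by simp) hw1
  exact ⟨K', V', C', hk, hv, by simpa [hm] using h0, by simpa [hm] using h1,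
    by simpa [hm] using hw, fun h => by simpa [hm] using h⟩

lemma ex_last (K T : Finset Pt) (hT : T ⊆ K) (hc : K.card = T.card + 1) :
    ∃ s, s ∉ T ∧ K = T ∪ {s} := by
  have h1 : (K \ T).card = 1 := by rw [Finset.card_sdiff_of_subset hT]; omega
  obtain ⟨s, hs⟩ := Finset.card_eq_one.1 h1
  have hs' : s ∈ K \ T := by rw [hs]; simp
  refine ⟨s, (Finset.mem_sdiff.1 hs').2, ?_⟩
  rw [← hs, Finset.union_sdiff_of_subset hT]

lemma four_arith (x y : ℤ) (hs : ¬((x = 0 ∧ y = 0) ∨ (x = 1 ∧ y = 0) ∨ (x = 0 ∧ y = 1)))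
    (h1 : -y ≤ 1) (h2 : -x ≤ 1) (h3 : x + y - 1 ≤ 1) :
    (y = -1 ∧ -1 ≤ x ∧ x ≤ 3) ∨ (x = -1 ∧ 0 ≤ y ∧ y ≤ 3) ∨ (x + y = 2 ∧ 0 ≤ x ∧ 0 ≤ y) := by
  omega

theorem Cfg.four {K V : Finset Pt} (C : Cfg K V) (hc : K.card = 4) : V.card ≤ 8 := by
  obtain ⟨a, ha, b, hb, hab⟩ := Finset.one_lt_card.1 (by omega : 1 < K.card)
  obtain ⟨u, g, hg, hu, -, hi⟩ := C.prim ha hb hab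
  have hu' := hu
  obtain ⟨p, q, hpq⟩ := hu
  obtain ⟨K1, V1, C1, hk1, hv1, hm1⟩ := C.trans a u (-q, p) 1 (by simp only; linarith) rfl
  have h0 : ((0, 0) : Pt) ∈ K1 := by simpa [hm1] using ha
  have h1 : ((1, 0) : Pt) ∈ K1 := by simpa [hm1] using hi 1 (by omega) (by omega)
  by_cases hcol : ∀ n ∈ K1, n.2 = 0
  · have := C1.collinear h0 h1 hcol
    omega
  obtain ⟨K2, V2, C2, hk2, hv2, h0, h1, h2, -⟩ := C1.tri h0 h1 hcol
  rw [← hv1, ← hv2]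
  obtain ⟨s, hs, hK⟩ := ex_last K2 {(0, 0), (1, 0), (0, 1)}
    (by intro x hx; simp only [Finset.mem_insert, Finset.mem_singleton] at hx
        rcases hx with rfl | rfl | rfl <;> assumption) (by rw [hk2, hk1, hc]; decide)
  have hK : K2 = {(0, 0), (1, 0), (0, 1), s} := by rw [hK]; ext x; simp [or_assoc]
  have hsK : s ∈ K2 := by rw [hK]; simp
  have A : ∀ x y : Pt, x ∈ K2 → y ∈ K2 → IsCoprime (y.1 - x.1) (y.2 - x.2) →
      edgeF (x, y) (0, 0) ≤ 0 → edgeF (x, y) (1, 0) ≤ 0 → edgeF (x, y) (0, 1) ≤ 0 →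
      edgeF (x, y) s ≤ 1 := by
    intro x y hx hy hco e1 e2 e3
    by_contra hlt
    obtain ⟨w, hw, hw1⟩ := C2.height hx hy (v := s) (by simp [hsK]) hco (by omega)
    rw [hK] at hw
    simp only [Finset.mem_insert, Finset.mem_singleton] at hw
    rcases hw with rfl | rfl | rfl | rfl <;> omega
  have A1 := A (1, 0) (0, 0) h1 h0 (Int.isCoprime_iff_gcd_eq_one.2 (by decide))
    (by decide) (by decide) (by decide)
  have A2 := A (0, 0) (0, 1) h0 h2 (Int.isCoprime_iff_gcd_eq_one.2 (by decide))
    (by decide) (by decide) (by decide)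
  have A3 := A (0, 1) (1, 0) h2 h1 (Int.isCoprime_iff_gcd_eq_one.2 (by decide))
    (by decide) (by decide) (by decide)
  subst hK
  clear hm1 hi hpq hu' A C C1 hab
  refine Cfg.cases_four s C2 ?_
  obtain ⟨x, y⟩ := s
  simp only [Finset.mem_insert, Finset.mem_singleton, Prod.mk.injEq] at hs
  simp only [edgeF] at A1 A2 A3
  have := four_arith x y hs (by linarith) (by linarith) (by linarith)
  simp only [Prod.mk.injEq]
  rcases this with ⟨rfl, h, h'⟩ | ⟨rfl, h, h'⟩ | ⟨h, h', h''⟩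
  · interval_cases x <;> decide
  · interval_cases y <;> decide
  · obtain rfl : y = 2 - x := by omega
    have : x ≤ 2 := by omega
    interval_cases x <;> decide

theorem Cfg.five {K V : Finset Pt} (C : Cfg K V) (hc : K.card = 5) : V.card ≤ 7 := by
  obtain ⟨a, ha, b, hb, hab, hpar⟩ := Finset.exists_ne_map_eq_of_card_lt_of_maps_to
    (s := K) (t := ({0, 1} : Finset ℤ) ×ˢ ({0, 1} : Finset ℤ)) (by rw [hc]; decide)
    (f := fun x => (x.1 % 2, x.2 % 2)) (by
      intro x _
      simp only [Finset.coe_product, Set.mem_prod, Finset.mem_coe, Finset.mem_insert,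
        Finset.mem_singleton]
      omega)
  simp only [Prod.mk.injEq] at hpar
  obtain ⟨u, g, hg, hu, hbg, hi⟩ := C.prim ha hb hab
  have hu' := hu
  obtain ⟨p, q, hpq⟩ := hu
  have hg2 : 2 ≤ g := by
    by_contra h
    have : g = 1 := by omega
    subst this
    subst hbg
    simp only at hpar
    have e1 : ∃ k, u.1 = 2 * k := ⟨u.1 / 2, by omega⟩
    have e2 : ∃ k, u.2 = 2 * k := ⟨u.2 / 2, by omega⟩
    obtain ⟨k, e1⟩ := e1
    obtain ⟨l, e2⟩ := e2
    rw [e1, e2] at hpq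
    have : 2 * (p * k + q * l) = 1 := by linarith
    omega
  obtain ⟨K1, V1, C1, hk1, hv1, hm1⟩ := C.trans (a.1 + u.1, a.2 + u.2) u (-q, p) 1
    (by simp only; linarith) rfl
  have h0 : ((0, 0) : Pt) ∈ K1 := by simpa [hm1] using hi 1 (by omega) (by omega)
  have h1 : ((1, 0) : Pt) ∈ K1 := by
    have := hi 2 (by omega) (by omega)
    rw [hm1]; convert this using 2 <;> ring
  have h3 : ((-1, 0) : Pt) ∈ K1 := by simpa [hm1] using ha
  by_cases hcol : ∀ n ∈ K1, n.2 = 0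
  · have := C1.collinear h0 h1 hcol
    omega
  obtain ⟨K2, V2, C2, hk2, hv2, h0, h1, h2, h3'⟩ := C1.tri h0 h1 hcol
  replace h3 := h3' h3
  rw [← hv1, ← hv2]
  obtain ⟨s, hs, hK⟩ := ex_last K2 {(-1, 0), (0, 0), (1, 0), (0, 1)}
    (by intro x hx; simp only [Finset.mem_insert, Finset.mem_singleton] at hx
        rcases hx with rfl | rfl | rfl | rfl <;> assumption) (by rw [hk2, hk1, hc]; decide)
  have hK : K2 = {(-1, 0), (0, 0), (1, 0), (0, 1), s} := by rw [hK]; ext x; simp [or_assoc]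
  have hsK : s ∈ K2 := by rw [hK]; simp
  clear hm1 hi hpq hu' hbg hpar hab h3' hcol C C1
  obtain ⟨c, d⟩ := s
  have mem : ∀ x y : ℤ, (x, y) ∈ K2 → (x = -1 ∧ y = 0) ∨ (x = 0 ∧ y = 0) ∨ (x = 1 ∧ y = 0) ∨
      (x = 0 ∧ y = 1) ∨ (x = c ∧ y = d) := by
    intro x y h; rw [hK] at h; simpa using h
  simp only [Finset.mem_insert, Finset.mem_singleton, Prod.mk.injEq] at hs
  have goal : (d = 0 ∧ (c = -2 ∨ c = 2)) ∨ (d = 1 ∧ (c = 1 ∨ c = -1)) ∨ (d = 2 ∧ c = 0) ∨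
      (d = -1 ∧ -3 ≤ c ∧ c ≤ 3) := by
    rcases lt_trichotomy d 0 with hd | hd | hd
    · have d1 : d = -1 := by
        by_contra hd1
        obtain ⟨⟨x, y⟩, hw, hw1⟩ := C2.height h1 h0 (v := (c, d)) (by simp [hsK])
          (Int.isCoprime_iff_gcd_eq_one.2 (by decide)) (by simp only [edgeF]; omega)
        have := mem x y hw
        simp only [edgeF] at hw1
        omega
      subst d1
      have c1 : c ≤ 3 := by
        by_contra hc1
        have := C2.kclosed (2, 0) h1 h2 hsK (c - 4) 1 1 (by omega) (by omega) (by omega) (by omega)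
          (by simp only; ring) (by simp only; ring)
        have := mem _ _ this
        omega
      have c2 : -3 ≤ c := by
        by_contra hc1
        have := C2.kclosed (-2, 0) h3 h2 hsK (-c - 4) 1 1 (by omega) (by omega) (by omega)
          (by omega) (by simp only; ring) (by simp only; ring)
        have := mem _ _ this
        omega
      omega
    · subst hd
      have c1 : c ≤ 2 := by
        by_contra hc1
        have := C2.kclosed (2, 0) h1 hsK hsK (c - 2) 1 0 (by omega) (by omega) (by omega) (by omega)
          (by simp only; ring) (by simp only; ring)
        have := mem _ _ this
        omega
      have c2 : -2 ≤ c := by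
        by_contra hc1
        have := C2.kclosed (-2, 0) h3 hsK hsK (-c - 2) 1 0 (by omega) (by omega) (by omega)
          (by omega) (by simp only; ring) (by simp only; ring)
        have := mem _ _ this
        omega
      omega
    · by_cases d1 : d = 1
      · subst d1
        have c1 : c ≤ 1 := by
          by_contra hc1
          have := C2.kclosed (1, 1) h2 hsK hsK (c - 1) 1 0 (by omega) (by omega) (by omega)
            (by omega) (by simp only; ring) (by simp only; ring)
          have := mem _ _ this
          omega
        have c2 : -1 ≤ c := by
          by_contra hc1
          have := C2.kclosed (-1, 1) h2 hsK hsK (-c - 1) 1 0 (by omega) (by omega) (by omega)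
            (by omega) (by simp only; ring) (by simp only; ring)
          have := mem _ _ this
          omega
        omega
      · have c1 : c = 0 := by
          obtain ⟨t, t1, t2⟩ := ceil_ex c d hd
          have a1 := C2.kclosed (t, 1) hsK h0 h1 1 (d - 1 - (d * t - c)) (d * t - c) (by omega)
            (by omega) (by omega) (by omega) (by simp only; ring) (by simp only; ring)
          have a1 := mem _ _ a1
          have t0 : t = 0 := by omega
          subst t0
          obtain ⟨t, t3, t4⟩ := ceil_ex (c - (d - 1)) d hd
          have a1 := C2.kclosed (t, 1) hsK h0 h3 1 (d * t - (c - (d - 1)))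
            (d - 1 - (d * t - (c - (d - 1)))) (by omega)
            (by omega) (by omega) (by omega) (by simp only; ring) (by simp only; ring)
          have a1 := mem _ _ a1
          have t0 : t = 0 := by omega
          subst t0
          omega
        subst c1
        have d2 : d ≤ 2 := by
          by_contra hd2
          have := C2.kclosed (0, 2) h2 hsK hsK (d - 2) 1 0 (by omega) (by omega) (by omega)
            (by omega) (by simp only; ring) (by simp only; ring)
          have := mem _ _ this
          omega
        omega
  subst hK
  refine Cfg.cases_five _ C2 ?_
  rcases goal with ⟨rfl, rfl | rfl⟩ | ⟨rfl, rfl | rfl⟩ | ⟨rfl, rfl⟩ | ⟨rfl, h, h'⟩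
  all_goals first | decide | (interval_cases c <;> decide)

lemma thresholds {ι : Type*} [Fintype ι] [DecidableEq ι] (B : Finset Pt) (f : ι → Pt → ℝ)
    (b : ι → ℝ) (h : ∀ i, ∃ z ∈ B, b i < f i z ∧ ∀ j ≠ i, f j z ≤ b j) :
    ∃ (β : ι → ℝ) (z : ι → Pt), (∀ i, z i ∈ B ∧ f i (z i) = β i ∧ ∀ j ≠ i, f j (z i) < β j) ∧
      ∀ x ∈ B, (∀ j, f j x < β j) ↔ (∀ j, f j x ≤ b j) := by
  -- initial strict thresholds
  have h0 : ∀ i, ∃ β : ℝ, ∀ x ∈ B, f i x < β ↔ f i x ≤ b i := by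
    intro i
    obtain ⟨z, hz, hz1, -⟩ := h i
    obtain ⟨y, hy, hy1⟩ := (B.filter (fun x => b i < f i x)).exists_min_image (f i)
      ⟨z, by simp [hz, hz1]⟩
    rw [Finset.mem_filter] at hy
    refine ⟨f i y, fun x hx => ⟨fun hlt => ?_, fun hle => lt_of_le_of_lt hle hy.2⟩⟩
    by_contra hc
    have := hy1 x (by rw [Finset.mem_filter]; exact ⟨hx, not_le.1 hc⟩)
    linarith
  choose β0 hβ0 using h0
  have step : ∀ T : Finset ι, ∃ (β : ι → ℝ) (z : ι → Pt),
      (∀ i, z i ∈ B ∧ β i ≤ f i (z i) ∧ (i ∈ T → f i (z i) = β i) ∧ ∀ j ≠ i, f j (z i) < β j) ∧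
      ∀ x ∈ B, (∀ j, f j x < β j) ↔ (∀ j, f j x ≤ b j) := by
    intro T
    induction T using Finset.induction_on with
    | empty =>
      choose z hz hz1 hz2 using h
      refine ⟨β0, z, fun i => ⟨hz i, ?_, by simp, fun j hj => (hβ0 j _ (hz i)).2 (hz2 i j hj)⟩,
        fun x hx => forall_congr' fun j => hβ0 j x hx⟩
      by_contra hc
      have := (hβ0 i _ (hz i)).1 (not_le.1 hc)
      linarith [hz1 i]
    | insert i T hi ih =>
      obtain ⟨β, z, hz, hB⟩ := ih
      obtain ⟨y, hy, hy1⟩ := (B.filter (fun x => β i ≤ f i x ∧ ∀ j ≠ i, f j x < β j)).exists_min_image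
        (f i) ⟨z i, by rw [Finset.mem_filter]; exact ⟨(hz i).1, (hz i).2.1, (hz i).2.2.2⟩⟩
      rw [Finset.mem_filter] at hy
      obtain ⟨hyB, hyi, hyj⟩ := hy
      refine ⟨Function.update β i (f i y), Function.update z i y, fun k => ?_, fun x hx => ?_⟩
      · by_cases hk : k = i
        · subst hk
          simp only [Function.update_self]
          refine ⟨hyB, le_rfl, by simp, fun j hj => ?_⟩
          rw [Function.update_of_ne hj]; exact hyj j hj
        · rw [Function.update_of_ne hk, Function.update_of_ne hk]
          obtain ⟨a1, a2, a3, a4⟩ := hz k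
          refine ⟨a1, a2, fun hkT => a3 (Finset.mem_of_mem_insert_of_ne hkT hk), fun j hj => ?_⟩
          by_cases hji : j = i
          · subst hji
            rw [Function.update_self]
            exact lt_of_lt_of_le (a4 j hj) hyi
          · rw [Function.update_of_ne hji]; exact a4 j hj
      · rw [← hB x hx]
        constructor
        · intro hx1
          have hne : ∀ j ≠ i, f j x < β j := fun j hj => by
            have := hx1 j; rwa [Function.update_of_ne hj] at this
          intro j
          by_cases hj : j = i
          · subst hj
            by_contra hc
            have := hy1 x (by rw [Finset.mem_filter]; exact ⟨hx, not_lt.1 hc, hne⟩)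
            have h2 := hx1 j
            rw [Function.update_self] at h2
            linarith
          · exact hne j hj
        · intro hx1 j
          by_cases hj : j = i
          · subst hj; rw [Function.update_self]; exact lt_of_lt_of_le (hx1 j) hyi
          · rw [Function.update_of_ne hj]; exact hx1 j
  obtain ⟨β, z, hz, hB⟩ := step Finset.univ
  exact ⟨β, z, fun i => ⟨(hz i).1, (hz i).2.2.1 (Finset.mem_univ i), (hz i).2.2.2⟩, hB⟩

lemma wavg_le {α β γ x a b c M : ℤ} (h1 : 0 ≤ α) (h2 : 0 ≤ β) (h3 : 0 ≤ γ) (h : 0 < α + β + γ)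
    (e : (α + β + γ) * x = α * a + β * b + γ * c) (ha : a ≤ M) (hb : b ≤ M) (hc : c ≤ M) :
    x ≤ M := by
  by_contra hx
  have : (α + β + γ) * M < (α + β + γ) * x := by
    apply mul_lt_mul_of_pos_left _ h; omega
  nlinarith [mul_le_mul_of_nonneg_left ha h1, mul_le_mul_of_nonneg_left hb h2,
    mul_le_mul_of_nonneg_left hc h3]

/-- From linear constraints to a configuration. -/
lemma cfg_of_system {ι : Type*} [Fintype ι] [DecidableEq ι] (M : ℤ) (p q b : ι → ℝ)
    (h : ∀ i, ∃ z ∈ (Finset.Icc (-M) M ×ˢ Finset.Icc (-M) M : Finset Pt),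
      b i < p i * z.1 + q i * z.2 ∧ ∀ j ≠ i, p j * z.1 + q j * z.2 ≤ b j) :
    ∃ K V : Finset Pt, Cfg K V ∧ V.card = Fintype.card ι ∧ ∀ x, x ∈ K ↔
      x ∈ (Finset.Icc (-M) M ×ˢ Finset.Icc (-M) M : Finset Pt) ∧
        ∀ j, p j * x.1 + q j * x.2 ≤ b j := by
  classical
  set B := (Finset.Icc (-M) M ×ˢ Finset.Icc (-M) M : Finset Pt) with hBdef
  obtain ⟨β, z, hz, hB⟩ := thresholds B (fun i x => p i * x.1 + q i * x.2) b h
  have zinj : Function.Injective z := by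
    intro i j hij
    by_contra hne
    have h1 := (hz i).2.1
    have h2 := (hz j).2.2 i hne
    rw [← hij] at h2
    linarith
  refine ⟨B.filter (fun x => ∀ j, p j * x.1 + q j * x.2 ≤ b j), Finset.univ.image z, ⟨?_, ?_⟩,
    by rw [Finset.card_image_of_injective _ zinj, Finset.card_univ], fun x => Finset.mem_filter⟩
  · rw [Finset.disjoint_left]
    intro x hx hy
    rw [Finset.mem_filter] at hx
    obtain ⟨i, -, rfl⟩ := Finset.mem_image.1 hy
    have := (hB _ hx.1).2 hx.2 i
    linarith [(hz i).2.1]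
  · have hpt : ∀ x ∈ B.filter (fun x => ∀ j, p j * x.1 + q j * x.2 ≤ b j) ∪ Finset.univ.image z,
        x ∈ B ∧ ∀ j, p j * x.1 + q j * x.2 < β j ∨ x = z j := by
      intro x hx
      rw [Finset.mem_union, Finset.mem_filter, Finset.mem_image] at hx
      rcases hx with ⟨hx, hx2⟩ | ⟨i, -, rfl⟩
      · exact ⟨hx, fun j => Or.inl ((hB x hx).2 hx2 j)⟩
      · refine ⟨(hz i).1, fun j => ?_⟩
        by_cases hj : j = i
        · subst hj; exact Or.inr rfl
        · exact Or.inl ((hz i).2.2 j hj)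
    intro a b' c w ha hb hc α β' γ h1 h2 h3 h4 e1 e2
    obtain ⟨haB, ha⟩ := hpt a ha
    obtain ⟨hbB, hb⟩ := hpt b' hb
    obtain ⟨hcB, hc⟩ := hpt c hc
    by_contra hcon
    push Not at hcon
    obtain ⟨hwK, hwa, hwb, hwc⟩ := hcon
    apply hwK
    rw [hBdef, Finset.mem_product, Finset.mem_Icc, Finset.mem_Icc] at haB hbB hcB
    have hwB : w ∈ B := by
      rw [hBdef, Finset.mem_product, Finset.mem_Icc, Finset.mem_Icc]
      refine ⟨⟨?_, ?_⟩, ?_, ?_⟩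
      · have := wavg_le (x := -w.1) (a := -a.1) (b := -b'.1) (c := -c.1) (M := M) h1 h2 h3 h4
          (by linarith) (by omega) (by omega) (by omega)
        omega
      · exact wavg_le h1 h2 h3 h4 e1 haB.1.2 hbB.1.2 hcB.1.2
      · have := wavg_le (x := -w.2) (a := -a.2) (b := -b'.2) (c := -c.2) (M := M) h1 h2 h3 h4
          (by linarith) (by omega) (by omega) (by omega)
        omega
      · exact wavg_le h1 h2 h3 h4 e2 haB.2.2 hbB.2.2 hcB.2.2
    rw [Finset.mem_filter]
    refine ⟨hwB, (hB w hwB).1 fun j => ?_⟩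
    have hle : ∀ x : Pt, (p j * x.1 + q j * x.2 < β j ∨ x = z j) → p j * x.1 + q j * x.2 ≤ β j := by
      rintro x (hx | rfl)
      · exact hx.le
      · exact (hz j).2.1.le
    have la := hle a (ha j)
    have lb := hle b' (hb j)
    have lc := hle c (hc j)
    have r1 : ((α + β' + γ : ℤ) : ℝ) * w.1 = α * a.1 + β' * b'.1 + γ * c.1 := by exact_mod_cast e1
    have r2 : ((α + β' + γ : ℤ) : ℝ) * w.2 = α * a.2 + β' * b'.2 + γ * c.2 := by exact_mod_cast e2
    have r1' : (0 : ℝ) ≤ α := by exact_mod_cast h1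
    have r2' : (0 : ℝ) ≤ β' := by exact_mod_cast h2
    have r3' : (0 : ℝ) ≤ γ := by exact_mod_cast h3
    have r4' : (0 : ℝ) < ((α + β' + γ : ℤ) : ℝ) := by exact_mod_cast h4
    by_contra hge
    rw [not_lt] at hge
    have hge2 := mul_le_mul_of_nonneg_left hge r4'.le
    have heq : ((α + β' + γ : ℤ) : ℝ) * (p j * w.1 + q j * w.2) =
        α * (p j * a.1 + q j * a.2) + β' * (p j * b'.1 + q j * b'.2) +
        γ * (p j * c.1 + q j * c.2) := by
      linear_combination p j * r1 + q j * r2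
    rw [heq] at hge2
    push_cast at hge2
    have ma := mul_le_mul_of_nonneg_left la r1'
    have mb := mul_le_mul_of_nonneg_left lb r2'
    have mc := mul_le_mul_of_nonneg_left lc r3'
    have za : α = 0 ∨ a = z j := by
      rcases ha j with hs | hs
      · left
        by_contra hne
        have : (0 : ℝ) < α := by exact_mod_cast lt_of_le_of_ne h1 (Ne.symm hne)
        have := mul_lt_mul_of_pos_left hs this
        linarith
      · exact Or.inr hs
    have zb : β' = 0 ∨ b' = z j := by
      rcases hb j with hs | hs
      · left
        by_contra hne
        have : (0 : ℝ) < β' := by exact_mod_cast lt_of_le_of_ne h2 (Ne.symm hne)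
        have := mul_lt_mul_of_pos_left hs this
        linarith
      · exact Or.inr hs
    have zc : γ = 0 ∨ c = z j := by
      rcases hc j with hs | hs
      · left
        by_contra hne
        have : (0 : ℝ) < γ := by exact_mod_cast lt_of_le_of_ne h3 (Ne.symm hne)
        have := mul_lt_mul_of_pos_left hs this
        linarith
      · exact Or.inr hs
    have wz : w = z j := by
      have q1 : ∀ (s : ℤ) (x : Pt), (s = 0 ∨ x = z j) → s * x.1 = s * (z j).1 ∧
          s * x.2 = s * (z j).2 := by
        rintro s x (rfl | rfl) <;> simp
      have a1 := q1 _ _ za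
      have a2 := q1 _ _ zb
      have a3 := q1 _ _ zc
      rw [a1.1, a2.1, a3.1, ← add_mul, ← add_mul] at e1
      rw [a1.2, a2.2, a3.2, ← add_mul, ← add_mul] at e2
      ext
      · exact mul_left_cancel₀ h4.ne' e1
      · exact mul_left_cancel₀ h4.ne' e2
    rw [wz] at hwa hwb hwc
    rcases za with za | za
    · rcases zb with zb | zb
      · rcases zc with zc | zc
        · omega
        · exact hwc zc.symm
      · exact hwb zb.symm
    · exact hwa za.symm

def embP (x : Pt) : Fin 2 → ℝ := ![(x.1 : ℝ), (x.2 : ℝ)]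

lemma embP_inj : Function.Injective embP := by
  intro x y h
  have h0 := congrFun h 0
  have h1 := congrFun h 1
  simp only [embP, Matrix.cons_val_zero, Matrix.cons_val_one, Int.cast_inj] at h0 h1
  exact Prod.ext h0 h1

lemma mem_intPts {m : ℕ} (A : Fin m → Fin 2 → ℝ) (b : Fin m → ℝ) (I : Set (Fin m))
    (x : Fin 2 → ℝ) : x ∈ intPts (polyI A b I) ↔
      ∃ p : Pt, embP p = x ∧ ∀ i ∈ I, A i 0 * p.1 + A i 1 * p.2 ≤ b i := by
  constructor
  · rintro ⟨h1, h2⟩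
    obtain ⟨u, hu⟩ := h2 0
    obtain ⟨v, hv⟩ := h2 1
    refine ⟨(u, v), ?_, fun i hi => ?_⟩
    · ext j; fin_cases j
      · simp [embP, hu]
      · simp [embP, hv]
    · have := h1 i hi
      rw [Fin.sum_univ_two, hu, hv] at this
      exact this
  · rintro ⟨p, rfl, h⟩
    refine ⟨fun i hi => ?_, fun j => ?_⟩
    · rw [Fin.sum_univ_two]; exact h i hi
    · fin_cases j
      · exact ⟨p.1, rfl⟩
      · exact ⟨p.2, rfl⟩

lemma embP_mem {m : ℕ} (A : Fin m → Fin 2 → ℝ) (b : Fin m → ℝ) (I : Set (Fin m))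
    (p : Pt) : embP p ∈ intPts (polyI A b I) ↔ ∀ i ∈ I, A i 0 * p.1 + A i 1 * p.2 ≤ b i := by
  rw [mem_intPts]
  constructor
  · rintro ⟨q, hq, h⟩
    rw [← embP_inj hq]; exact h
  · exact fun h => ⟨p, rfl, h⟩

lemma helly_of_cfg (k c : ℕ) (H : ∀ K V : Finset Pt, Cfg K V → K.card = k → V.card ≤ c) :
    HellyBound 2 k c := by
  classical
  intro m A b hfin hk
  set S := intPts (polyI A b Set.univ) with hS
  obtain ⟨I, hI, hmin⟩ := (Finset.univ.filter (fun I : Finset (Fin m) =>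
    intPts (polyI A b (↑I : Set (Fin m))) = S)).exists_min_image Finset.card
    ⟨Finset.univ, by simp [hS]⟩
  rw [Finset.mem_filter] at hI
  replace hI := hI.2
  refine ⟨I, ?_, hI⟩
  have hz : ∀ i : I, ∃ z : Pt, b i < A i 0 * z.1 + A i 1 * z.2 ∧
      ∀ j : I, j ≠ i → A j 0 * z.1 + A j 1 * z.2 ≤ b j := by
    rintro ⟨i, hi⟩
    by_contra hcon
    push Not at hcon
    have : intPts (polyI A b (↑(I.erase i) : Set (Fin m))) = S := by
      rw [← hI]
      ext x
      rw [mem_intPts, mem_intPts]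
      refine exists_congr fun p => and_congr_right fun _ => ⟨fun h => ?_, fun h j hj => ?_⟩
      · have h' : ∀ j ∈ I, j ≠ i → A j 0 * p.1 + A j 1 * p.2 ≤ b j := fun j hj hji =>
          h j (by simp [hji, hj])
        intro j hj
        by_cases hji : j = i
        · subst hji
          by_contra hlt
          obtain ⟨l, hl, hl2⟩ := hcon p (not_le.1 hlt)
          exact absurd (h' l l.2 (fun e => hl (Subtype.ext e))) (not_le.2 hl2)
        · exact h' j hj hji
      · exact h j (Finset.mem_coe.2 (Finset.mem_of_mem_erase (Finset.mem_coe.1 hj)))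
    have h1 := hmin (I.erase i) (Finset.mem_filter.2 ⟨Finset.mem_univ _, this⟩)
    have h2 := Finset.card_erase_lt_of_mem hi
    omega
  choose z hz1 hz2 using hz
  have hPfin : (embP ⁻¹' S).Finite := hfin.preimage embP_inj.injOn
  set F : Finset Pt := Finset.univ.image z ∪ hPfin.toFinset with hF
  set M : ℤ := ∑ x ∈ F, (|x.1| + |x.2|) with hM
  have hbox : ∀ x ∈ F, x ∈ (Finset.Icc (-M) M ×ˢ Finset.Icc (-M) M : Finset Pt) := by
    intro x hx
    have h1 : |x.1| + |x.2| ≤ M := Finset.single_le_sum (f := fun x : Pt => |x.1| + |x.2|)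
      (fun y _ => by positivity) hx
    rw [Finset.mem_product, Finset.mem_Icc, Finset.mem_Icc]
    have := abs_nonneg x.1
    have := abs_nonneg x.2
    exact ⟨abs_le.1 (by omega), abs_le.1 (by omega)⟩
  obtain ⟨K, V, C, hV, hK⟩ := cfg_of_system (ι := I) M (fun i => A i 0) (fun i => A i 1)
    (fun i => b i) (fun i => ⟨z i, hbox _ (by simp [hF]), hz1 i, hz2 i⟩)
  have hKS : S = embP '' (K : Set Pt) := by
    ext x
    constructor
    · intro hx
      have hx' := hx
      rw [← hI, mem_intPts] at hx'
      obtain ⟨p, rfl, hp⟩ := hx'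
      refine ⟨p, ?_, rfl⟩
      rw [Finset.mem_coe, hK]
      exact ⟨hbox p (by rw [hF, Finset.mem_union]; right; simpa using hx),
        fun j => hp j (Finset.mem_coe.2 j.2)⟩
    · rintro ⟨p, hp, rfl⟩
      rw [Finset.mem_coe, hK] at hp
      rw [← hI, embP_mem]
      exact fun i hi => hp.2 ⟨i, hi⟩
  have hcard : K.card = k := by
    rw [← hk, hKS, Set.ncard_image_of_injective _ embP_inj, Set.ncard_coe_finset]
  have := H K V C hcard
  rw [hV, Fintype.card_coe] at this
  exact this

lemma lower_bound {m k c : ℕ} (p q b : Fin m → ℤ) (S : Finset Pt) (hS : S.card = k)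
    (hmem : ∀ x : Pt, (∀ i, p i * x.1 + q i * x.2 ≤ b i) ↔ x ∈ S) (z : Fin m → Pt)
    (hz : ∀ i, b i < p i * (z i).1 + q i * (z i).2 ∧
      ∀ j, j ≠ i → p j * (z i).1 + q j * (z i).2 ≤ b j) (hc : HellyBound 2 k c) : m ≤ c := by
  have conv : ∀ i x, (![(p i : ℝ), (q i : ℝ)] 0 * ((x : Pt).1 : ℝ) +
      ![(p i : ℝ), (q i : ℝ)] 1 * (x.2 : ℝ) ≤ (b i : ℝ)) ↔ p i * x.1 + q i * x.2 ≤ b i := by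
    intro i x
    simp only [Matrix.cons_val_zero, Matrix.cons_val_one]
    norm_cast
  have hSeq : intPts (polyI (fun i => ![(p i : ℝ), (q i : ℝ)]) (fun i => (b i : ℝ)) Set.univ) =
      embP '' (S : Set Pt) := by
    ext x
    rw [mem_intPts]
    constructor
    · rintro ⟨y, rfl, hy⟩
      exact ⟨y, (hmem y).1 fun i => (conv i y).1 (hy i trivial), rfl⟩
    · rintro ⟨y, hy, rfl⟩
      exact ⟨y, rfl, fun i _ => (conv i y).2 ((hmem y).2 hy i)⟩
  obtain ⟨I, hI, hEq⟩ := hc m (fun i => ![(p i : ℝ), (q i : ℝ)]) (fun i => (b i : ℝ))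
    (by rw [hSeq]; exact S.finite_toSet.image _)
    (by rw [hSeq, Set.ncard_image_of_injective _ embP_inj, Set.ncard_coe_finset, hS])
  refine le_trans ?_ hI
  have : I = Finset.univ := by
    rw [Finset.eq_univ_iff_forall]
    intro i
    by_contra hi
    have h1 : embP (z i) ∈ intPts (polyI (fun i => ![(p i : ℝ), (q i : ℝ)])
        (fun i => (b i : ℝ)) (↑I : Set (Fin m))) := by
      rw [embP_mem]
      exact fun j hj => (conv j _).2 ((hz i).2 j fun e => hi (e ▸ hj))
    rw [hEq, embP_mem] at h1
    have := (conv i _).1 (h1 i trivial)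
    exact absurd this (not_le.2 (hz i).1)
  rw [this, Finset.card_univ, Fintype.card_fin]

lemma lower5 (c : ℕ) (hc : HellyBound 2 5 c) : 7 ≤ c := by
  refine lower_bound (m := 7) ![0, 2, 2, 1, -1, -1, -2] ![1, 1, -1, -2, -3, 0, 3]
    ![1, 4, 3, 2, 2, 1, 4] {(-1, 0), (0, 0), (1, 0), (0, 1), (1, 1)} (by decide) ?_
    ![(1, 2), (2, 1), (2, 0), (1, -1), (0, -1), (-2, 0), (-1, 1)] (by decide) hc
  rintro ⟨x, y⟩
  simp [Fin.forall_fin_succ]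
  omega

lemma lower4 (c : ℕ) (hc : HellyBound 2 4 c) : 8 ≤ c := by
  refine lower_bound (m := 8) ![-1, 1, 2, 2, 1, -1, -2, -2] ![-2, -2, -1, 1, 2, 2, 1, -1]
    ![-2, 1, 4, 7, 7, 4, 1, -2] {(1, 1), (1, 2), (2, 1), (2, 2)} (by decide) ?_
    ![(1, 0), (2, 0), (3, 1), (3, 2), (2, 3), (1, 3), (0, 2), (0, 1)] (by decide) hc
  rintro ⟨x, y⟩
  simp [Fin.forall_fin_succ]
  omega

lemma cnk_eq {k c : ℕ} (h1 : HellyBound 2 k c) (h2 : ∀ d, HellyBound 2 k d → c ≤ d) :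
    cnk 2 k = c :=
  le_antisymm (Nat.sInf_le h1) (le_csInf ⟨c, h1⟩ fun d hd => h2 d hd)

/-- `c(2,5) = 7` and `c(2,4) = 8`; in particular
`c(2,5) < c(2,4)`, so `c(n,k)` is not monotonically nondecreasing in `k`. -/
theorem stmt19 :
    cnk 2 5 = 7 ∧ cnk 2 4 = 8 ∧ cnk 2 5 < cnk 2 4 ∧ ¬ Monotone (cnk 2) := by
  have h5 : cnk 2 5 = 7 := cnk_eq (helly_of_cfg 5 7 fun _ _ C h => C.five h) lower5
  have h4 : cnk 2 4 = 8 := cnk_eq (helly_of_cfg 4 8 fun _ _ C h => C.four h) lower4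
  refine ⟨h5, h4, by omega, fun hm => ?_⟩
  have := hm (show 4 ≤ 5 by norm_num)
  omega
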